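/- Let Γ_j = R_j ℤ² for j = 1,…,N with rotations R_j such that Γ_j ∩ Γ_k = {0} for j ≠ k, and let ω = (1/N) Σ_j δ_{Γ_j}. Then the autocorrelation is γ_ω = ((N−1)/N)·λ + (1/N²) Σ_j δ_{Γ_j}, and the diffraction is γ̂_ω = ((N−1)/N)·δ_0 + (1/N)·((1/N) Σ_j δ̂_{Γ_j}). -/

import Mathlib

open MeasureTheory Real Filter
open scoped FourierTransform ENNReal

/-- The point of `ℂ` corresponding to `p ∈ ℤ²`. -/
noncomputable def latPt (p : ℤ × ℤ) : ℂ := (p.1 : ℂ) + (p.2 : ℂ) * Complex.I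

/-- The Dirac comb of the rotated square lattice `u·ℤ²`. -/
noncomputable def rotLatticeComb (u : ℂ) : Measure ℂ :=
  Measure.sum fun p : ℤ × ℤ => Measure.dirac (u * latPt p)

open Topology

section Lattice

@[simp] lemma latPt_re (p : ℤ × ℤ) : (latPt p).re = p.1 := by simp [latPt]

@[simp] lemma latPt_im (p : ℤ × ℤ) : (latPt p).im = p.2 := by simp [latPt]

lemma latPt_add (p q : ℤ × ℤ) : latPt (p + q) = latPt p + latPt q := by
  apply Complex.ext <;> simp

lemma latPt_sub (p q : ℤ × ℤ) : latPt (p - q) = latPt p - latPt q := by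
  apply Complex.ext <;> simp

lemma latPt_zero : latPt 0 = 0 := by
  apply Complex.ext <;> simp

lemma latPt_injective : Function.Injective latPt := by
  intro p q h
  have h1 := congrArg Complex.re h
  have h2 := congrArg Complex.im h
  simp only [latPt_re, latPt_im, Int.cast_inj] at h1 h2
  exact Prod.ext h1 h2

lemma finite_norm_latPt_lt (ρ : ℝ) : {p : ℤ × ℤ | ‖latPt p‖ < ρ}.Finite := by
  refine (Set.finite_Icc ((-⌈ρ⌉, -⌈ρ⌉) : ℤ × ℤ) (⌈ρ⌉, ⌈ρ⌉)).subset fun p hp => ?_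
  have hp : ‖latPt p‖ < ρ := hp
  have h1 := abs_le.1 ((Complex.abs_re_le_norm (latPt p)).trans (hp.le.trans (Int.le_ceil ρ)))
  have h2 := abs_le.1 ((Complex.abs_im_le_norm (latPt p)).trans (hp.le.trans (Int.le_ceil ρ)))
  simp only [latPt_re, latPt_im] at h1 h2
  norm_cast at h1 h2
  exact ⟨⟨h1.1, h2.1⟩, ⟨h1.2, h2.2⟩⟩

/-- The points of `ℤ²` in the open disk of radius `ρ`. -/
noncomputable def latticeDisk (ρ : ℝ) : Finset (ℤ × ℤ) := (finite_norm_latPt_lt ρ).toFinset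

@[simp] lemma mem_latticeDisk {ρ : ℝ} {p : ℤ × ℤ} : p ∈ latticeDisk ρ ↔ ‖latPt p‖ < ρ := by
  simp [latticeDisk]

/-- The integer part of a complex number, as a point of `ℤ²`. -/
noncomputable def latFloor (z : ℂ) : ℤ × ℤ := (⌊z.re⌋, ⌊z.im⌋)

lemma measurable_latFloor : Measurable latFloor :=
  (Int.measurable_floor.comp Complex.measurable_re).prodMk
    (Int.measurable_floor.comp Complex.measurable_im)

/-- The half-open unit square based at the lattice point `p`. -/
noncomputable def latCell (p : ℤ × ℤ) : Set ℂ := latFloor ⁻¹' {p}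

lemma measurableSet_latCell (p : ℤ × ℤ) : MeasurableSet (latCell p) :=
  measurable_latFloor (measurableSet_singleton p)

lemma pairwise_disjoint_latCell : Pairwise (Function.onFun Disjoint latCell) :=
  fun _ _ h => Disjoint.preimage _ (Set.disjoint_singleton.2 h)

lemma iUnion_latCell : ⋃ p, latCell p = Set.univ := by
  ext z; simp [latCell]

lemma preimage_add_latPt_latCell (p : ℤ × ℤ) :
    (fun z => latPt p + z) ⁻¹' latCell p = latCell 0 := by
  ext z
  simp [latCell, latFloor, Prod.ext_iff]

lemma latCell_eq (p : ℤ × ℤ) :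
    latCell p = Set.Ico (p.1 : ℝ) (p.1 + 1) ×ℂ Set.Ico (p.2 : ℝ) (p.2 + 1) := by
  ext z
  simp [latCell, latFloor, Prod.ext_iff, Complex.mem_reProdIm, Int.floor_eq_iff]

lemma norm_sub_latPt_le {p : ℤ × ℤ} {z : ℂ} (hz : z ∈ latCell p) : ‖z - latPt p‖ ≤ 2 := by
  rw [latCell_eq] at hz
  obtain ⟨⟨h1, h2⟩, h3, h4⟩ := hz
  refine (Complex.norm_le_abs_re_add_abs_im _).trans ?_
  have h5 : |(z - latPt p).re| ≤ 1 := by simp only [Complex.sub_re, latPt_re, abs_le]; grind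
  have h6 : |(z - latPt p).im| ≤ 1 := by simp only [Complex.sub_im, latPt_im, abs_le]; grind
  linarith

lemma volume_latCell (p : ℤ × ℤ) : volume (latCell p) = 1 := by
  have h : latCell p = Complex.measurableEquivRealProd ⁻¹'
      (Set.Ico (p.1 : ℝ) (p.1 + 1) ×ˢ Set.Ico (p.2 : ℝ) (p.2 + 1)) := by
    rw [latCell_eq]; ext z; simp [Complex.mem_reProdIm]
  rw [h, Complex.volume_preserving_equiv_real_prod.measure_preimage_equiv,
    Measure.volume_eq_prod, Measure.prod_prod]
  simp

lemma volume_iUnion_latCell (s : Finset (ℤ × ℤ)) :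
    volume (⋃ p ∈ s, latCell p) = ENNReal.ofReal s.card := by
  rw [measure_biUnion_finset (fun p _ q _ h => pairwise_disjoint_latCell h)
    (fun p _ => measurableSet_latCell p)]
  simp [volume_latCell]

lemma volume_ball_eq_ofReal {ρ : ℝ} (hρ : 0 ≤ ρ) :
    volume (Metric.ball (0 : ℂ) ρ) = ENNReal.ofReal (π * ρ ^ 2) := by
  rw [Complex.volume_ball, mul_comm, ENNReal.ofReal_mul pi_nonneg, ENNReal.ofReal_pow hρ,
    ← NNReal.coe_real_pi, ENNReal.ofReal_coe_nnreal]

lemma card_latticeDisk_le {ρ : ℝ} (hρ : -2 ≤ ρ) :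
    ((latticeDisk ρ).card : ℝ) ≤ π * (ρ + 2) ^ 2 := by
  have h : (⋃ p ∈ latticeDisk ρ, latCell p) ⊆ Metric.ball 0 (ρ + 2) := by
    refine Set.iUnion₂_subset fun p hp z hz => ?_
    have h1 := norm_sub_latPt_le hz
    have h2 := norm_le_norm_add_norm_sub' z (latPt p)
    rw [mem_latticeDisk] at hp
    rw [mem_ball_zero_iff]
    linarith
  have h := measure_mono (μ := volume) h
  rw [volume_iUnion_latCell, volume_ball_eq_ofReal (by linarith)] at h
  exact (ENNReal.ofReal_le_ofReal_iff (by positivity)).1 h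

lemma le_card_latticeDisk {ρ : ℝ} (hρ : 2 ≤ ρ) :
    π * (ρ - 2) ^ 2 ≤ ((latticeDisk ρ).card : ℝ) := by
  have h : Metric.ball 0 (ρ - 2) ⊆ (⋃ p ∈ latticeDisk ρ, latCell p) := by
    intro z hz
    have hz' : z ∈ latCell (latFloor z) := rfl
    have h1 := norm_sub_latPt_le hz'
    have h2 := norm_le_norm_add_norm_sub z (latPt (latFloor z))
    rw [mem_ball_zero_iff] at hz
    refine Set.mem_iUnion₂.2 ⟨latFloor z, ?_, hz'⟩
    rw [mem_latticeDisk]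
    linarith
  have h := measure_mono (μ := volume) h
  rw [volume_iUnion_latCell, volume_ball_eq_ofReal (by linarith)] at h
  exact (ENNReal.ofReal_le_ofReal_iff (by positivity)).1 h

lemma tendsto_disk_area_ratio (c : ℝ) :
    Tendsto (fun ρ : ℝ => π * (ρ + c) ^ 2 / (π * ρ ^ 2)) atTop (𝓝 1) := by
  have h : Tendsto (fun ρ : ℝ => (1 + c / ρ) ^ 2) atTop (𝓝 ((1 + 0) ^ 2)) :=
    (tendsto_const_nhds.add (tendsto_const_nhds.div_atTop tendsto_id)).pow 2
  rw [show (1 + 0 : ℝ) ^ 2 = 1 by norm_num] at h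
  refine h.congr' ?_
  filter_upwards [eventually_gt_atTop 0] with ρ hρ
  have := pi_pos
  field_simp

/-- Main term of the Gauss circle problem: a disk of radius `ρ + c` has `(1 + o(1)) π ρ²` lattice
points. -/
lemma tendsto_card_latticeDisk (c : ℝ) :
    Tendsto (fun ρ : ℝ => ((latticeDisk (ρ + c)).card : ℝ) / (π * ρ ^ 2)) atTop (𝓝 1) := by
  refine tendsto_of_tendsto_of_tendsto_of_le_of_le' (tendsto_disk_area_ratio (c - 2))
    (tendsto_disk_area_ratio (c + 2)) ?_ ?_
  · filter_upwards [eventually_ge_atTop (2 - c)] with ρ hρ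
    have := le_card_latticeDisk (ρ := ρ + c) (by linarith)
    rw [add_sub_assoc] at this
    gcongr
  · filter_upwards [eventually_ge_atTop (-2 - c)] with ρ hρ
    have := card_latticeDisk_le (ρ := ρ + c) (by linarith)
    rw [add_assoc] at this
    gcongr

lemma latticeDisk_mono : Monotone latticeDisk := fun _ _ h _ hp =>
  mem_latticeDisk.2 ((mem_latticeDisk.1 hp).trans_le h)

/-- Annuli of bounded width have density zero. -/
lemma tendsto_card_annulus (b c : ℝ) (hbc : b ≤ c) :
    Tendsto (fun ρ : ℝ =>
      ((latticeDisk (ρ + c) \ latticeDisk (ρ + b)).card : ℝ) / (π * ρ ^ 2)) atTop (𝓝 0) := by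
  have h := (tendsto_card_latticeDisk c).sub (tendsto_card_latticeDisk b)
  rw [sub_self] at h
  refine h.congr fun ρ => ?_
  have hsub := latticeDisk_mono (show ρ + b ≤ ρ + c by linarith)
  rw [Finset.card_sdiff_of_subset hsub, Nat.cast_sub (Finset.card_le_card hsub), sub_div]

end Lattice

section Periodization

/-- The `ℤ²`-periodization of a function on `ℂ`. -/
noncomputable def latPer (g : ℂ → ℂ) (z : ℂ) : ℂ := ∑' p, g (latPt p + z)

lemma apply_latPt_add_eq_zero {g : ℂ → ℂ} {r R : ℝ} (hg : ∀ z, r ≤ ‖z‖ → g z = 0) {z : ℂ}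
    (hz : ‖z‖ ≤ R) {p : ℤ × ℤ} (hp : p ∉ latticeDisk (R + r)) : g (latPt p + z) = 0 := by
  rw [mem_latticeDisk, not_lt] at hp
  refine hg _ ?_
  have := norm_le_add_norm_add (latPt p) z
  linarith

lemma latPer_eq_sum {g : ℂ → ℂ} {r R : ℝ} (hg : ∀ z, r ≤ ‖z‖ → g z = 0) {z : ℂ}
    (hz : ‖z‖ ≤ R) : latPer g z = ∑ p ∈ latticeDisk (R + r), g (latPt p + z) :=
  tsum_eq_sum fun _ hp => apply_latPt_add_eq_zero hg hz hp

lemma latPer_latPt_add (g : ℂ → ℂ) (q : ℤ × ℤ) (z : ℂ) : latPer g (latPt q + z) = latPer g z := by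
  rw [latPer, latPer, ← (Equiv.addRight q).tsum_eq (fun p => g (latPt p + z))]
  simp [latPt_add, add_assoc]

lemma continuous_latPer {g : ℂ → ℂ} (hc : Continuous g) {r : ℝ} (hg : ∀ z, r ≤ ‖z‖ → g z = 0) :
    Continuous (latPer g) := by
  rw [continuous_iff_continuousAt]
  intro z
  have h : ContinuousAt (fun y => ∑ p ∈ latticeDisk (‖z‖ + 1 + r), g (latPt p + y)) z := by
    fun_prop
  refine h.congr ?_
  filter_upwards [Metric.ball_mem_nhds z one_pos] with y hy
  refine (latPer_eq_sum hg ?_).symm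
  have := norm_le_norm_add_norm_sub' y z
  rw [mem_ball_iff_norm] at hy
  linarith

lemma norm_le_of_mem_latCell_zero {z : ℂ} (hz : z ∈ latCell 0) : ‖z‖ ≤ 2 := by
  simpa [latPt_zero] using norm_sub_latPt_le hz

lemma setIntegral_latCell (g : ℂ → ℂ) (p : ℤ × ℤ) :
    ∫ z in latCell p, g z = ∫ z in latCell 0, g (latPt p + z) := by
  rw [← preimage_add_latPt_latCell p]
  exact ((measurePreserving_add_left volume (latPt p)).setIntegral_preimage_emb
    (measurableEmbedding_addLeft _) g _).symm

lemma setIntegral_latPer {g : ℂ → ℂ} (hc : Continuous g) {r : ℝ}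
    (hg : ∀ z, r ≤ ‖z‖ → g z = 0) : ∫ z in latCell 0, latPer g z = ∫ z, g z := by
  have hcs : HasCompactSupport g := HasCompactSupport.intro (isCompact_closedBall 0 r)
    fun z hz => hg z (by simpa using (not_le.1 (by simpa using hz)).le)
  have hint : Integrable g := hc.integrable_of_hasCompactSupport hcs
  have h1 : ∀ z ∈ latCell 0, latPer g z = ∑ p ∈ latticeDisk (2 + r), g (latPt p + z) :=
    fun z hz => latPer_eq_sum hg (norm_le_of_mem_latCell_zero hz)
  rw [setIntegral_congr_fun (measurableSet_latCell 0) h1, integral_finsetSum _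
    fun p _ => (hint.comp_add_left (latPt p)).integrableOn, ← setIntegral_univ, ← iUnion_latCell,
    integral_iUnion measurableSet_latCell pairwise_disjoint_latCell
      (by rw [iUnion_latCell]; exact hint.integrableOn)]
  simp_rw [setIntegral_latCell g]
  refine (tsum_eq_sum fun p hp => ?_).symm
  exact setIntegral_eq_zero_of_forall_eq_zero fun z hz =>
    apply_latPt_add_eq_zero hg (norm_le_of_mem_latCell_zero hz) hp

end Periodization

section Torus

/-- The projection of `ℂ` to the torus `ℂ / ℤ²`. -/
noncomputable def toTorus (z : ℂ) : UnitAddTorus (Fin 2) :=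
  Pi.map (fun _ => QuotientAddGroup.mk) (Complex.equivRealProdCLM.toHomeomorph.trans
    (Homeomorph.finTwoArrow (X := ℝ)).symm z)

lemma toTorus_zero_apply (z : ℂ) : toTorus z 0 = (z.re : UnitAddCircle) := rfl

lemma toTorus_one_apply (z : ℂ) : toTorus z 1 = (z.im : UnitAddCircle) := rfl

lemma isQuotientMap_toTorus : IsQuotientMap toTorus :=
  ((IsOpenQuotientMap.piMap fun _ => QuotientAddGroup.isOpenQuotientMap_mk).comp
    (Homeomorph.isOpenQuotientMap _)).isQuotientMap

lemma exists_latPt_add_of_toTorus_eq {z y : ℂ} (h : toTorus z = toTorus y) :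
    ∃ p, z = latPt p + y := by
  have h0 := congrFun h 0
  have h1 := congrFun h 1
  rw [toTorus_zero_apply, toTorus_zero_apply, ← sub_eq_zero, ← AddCircle.coe_sub,
    AddCircle.coe_eq_zero_iff] at h0
  rw [toTorus_one_apply, toTorus_one_apply, ← sub_eq_zero, ← AddCircle.coe_sub,
    AddCircle.coe_eq_zero_iff] at h1
  obtain ⟨m, hm⟩ := h0
  obtain ⟨n, hn⟩ := h1
  refine ⟨(m, n), Complex.ext ?_ ?_⟩
  · simp_all
  · simp_all

lemma exists_comp_toTorus_eq {h : ℂ → ℂ} (hc : Continuous h)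
    (hp : ∀ p z, h (latPt p + z) = h z) :
    ∃ F : C(UnitAddTorus (Fin 2), ℂ), ∀ z, F (toTorus z) = h z := by
  let T : C(ℂ, UnitAddTorus (Fin 2)) := ⟨toTorus, isQuotientMap_toTorus.continuous⟩
  have hT : IsQuotientMap T := isQuotientMap_toTorus
  have hf : Function.FactorsThrough (⟨h, hc⟩ : C(ℂ, ℂ)) T := by
    intro z y hzy
    obtain ⟨p, rfl⟩ := exists_latPt_add_of_toTorus_eq hzy
    exact hp p y
  exact ⟨hT.lift ⟨h, hc⟩ hf, fun z => congrFun (congrArg DFunLike.coe (hT.lift_comp ⟨h, hc⟩ hf)) z⟩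

open UnitAddTorus in
lemma mFourier_toTorus (n : Fin 2 → ℤ) (z : ℂ) :
    mFourier n (toTorus z) = Complex.exp (2 * π * Complex.I * n 0 * z.re) *
      Complex.exp (2 * π * Complex.I * n 1 * z.im) := by
  simp only [mFourier, ContinuousMap.coe_mk, Fin.prod_univ_two, toTorus_zero_apply,
    toTorus_one_apply, fourier_coe_apply]
  simp

lemma integral_exp_two_pi_eq_zero {k : ℤ} (hk : k ≠ 0) :
    ∫ x in Set.Ico (0 : ℝ) 1, Complex.exp (2 * π * Complex.I * k * x) = 0 := by
  rw [integral_Ico_eq_integral_Ioc, ← intervalIntegral.integral_of_le zero_le_one,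
    integral_exp_mul_complex (by simp [hk, pi_ne_zero])]
  have := Complex.exp_int_mul_two_pi_mul_I k
  rw [Complex.ofReal_one, mul_one, mul_comm, this]
  simp

open UnitAddTorus in
lemma setIntegral_mFourier {n : Fin 2 → ℤ} (hn : n ≠ 0) :
    ∫ z in latCell 0, mFourier n (toTorus z) = 0 := by
  have h : latCell 0 = Complex.measurableEquivRealProd ⁻¹'
      (Set.Ico (0 : ℝ) 1 ×ˢ Set.Ico (0 : ℝ) 1) := by
    rw [latCell_eq]; ext z; simp [Complex.mem_reProdIm]
  simp_rw [mFourier_toTorus]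
  rw [h]
  refine (Complex.volume_preserving_equiv_real_prod.setIntegral_preimage_emb
    Complex.measurableEquivRealProd.measurableEmbedding (fun x : ℝ × ℝ =>
      Complex.exp (2 * π * Complex.I * n 0 * x.1) * Complex.exp (2 * π * Complex.I * n 1 * x.2))
      _).trans ?_
  rw [Measure.volume_eq_prod, setIntegral_prod_mul (fun x : ℝ =>
    Complex.exp (2 * π * Complex.I * n 0 * x)) (fun x : ℝ =>
    Complex.exp (2 * π * Complex.I * n 1 * x)), mul_eq_zero]
  by_contra! hne
  refine hn (funext fun i => ?_)
  by_contra hi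
  fin_cases i
  · exact hne.1 (integral_exp_two_pi_eq_zero hi)
  · exact hne.2 (integral_exp_two_pi_eq_zero hi)

end Torus

section Equidistribution

open UnitAddTorus

lemma mFourier_toTorus_add (n : Fin 2 → ℤ) (z y : ℂ) :
    mFourier n (toTorus (z + y)) = mFourier n (toTorus z) * mFourier n (toTorus y) := by
  simp only [mFourier_toTorus, ← Complex.exp_add]
  congr 1
  push_cast [Complex.add_re, Complex.add_im]
  ring

lemma exists_int_of_mFourier_eq_one {n : Fin 2 → ℤ} {z : ℂ} (h : mFourier n (toTorus z) = 1) :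
    ∃ k : ℤ, n 0 * z.re + n 1 * z.im = k := by
  rw [mFourier_toTorus, ← Complex.exp_add, Complex.exp_eq_one_iff] at h
  obtain ⟨k, hk⟩ := h
  refine ⟨k, ?_⟩
  have h2 : (2 * π * Complex.I : ℂ) ≠ 0 := Complex.two_pi_I_ne_zero
  have : ((n 0 * z.re + n 1 * z.im : ℝ) : ℂ) = (k : ℝ) := by
    apply mul_left_cancel₀ h2
    push_cast
    linear_combination hk
  exact_mod_cast this

/-- A character of `ℂ / ℤ²` that is trivial on `w ℤ²` is trivial, because `ℤ²` is self-dual. -/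
lemma exists_mFourier_ne_one {w : ℂ} (hw : ‖w‖ = 1)
    (hgen : ∀ p q, latPt p = w * latPt q → p = 0) {n : Fin 2 → ℤ} (hn : n ≠ 0) :
    ∃ b, ‖latPt b‖ = 1 ∧ mFourier n (toTorus (w * latPt b)) ≠ 1 := by
  by_contra! h
  obtain ⟨k, hk⟩ := exists_int_of_mFourier_eq_one (h (1, 0) (by simp [latPt]))
  obtain ⟨l, hl⟩ := exists_int_of_mFourier_eq_one (h (0, 1) (by simp [latPt]))
  have hw' : w.re * w.re + w.im * w.im = 1 := by
    rw [← Complex.normSq_apply, Complex.normSq_eq_norm_sq, hw, one_pow]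
  simp only [Complex.mul_re, Complex.mul_im, latPt_re, latPt_im] at hk hl
  have h0 := hgen (n 0, n 1) (k, l) (by
    apply Complex.ext
    · simp only [Complex.mul_re, latPt_re, latPt_im, ← hk, ← hl]
      push_cast
      linear_combination -(n 0 : ℝ) * hw'
    · simp only [Complex.mul_im, latPt_re, latPt_im, ← hk, ← hl]
      push_cast
      linear_combination -(n 1 : ℝ) * hw')
  rw [Prod.ext_iff] at h0
  exact hn (funext fun i => by fin_cases i <;> simp_all)

lemma norm_mFourier_apply (n : Fin 2 → ℤ) (x : UnitAddTorus (Fin 2)) : ‖mFourier n x‖ = 1 := by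
  simp only [mFourier, ContinuousMap.coe_mk, norm_prod, fourier_apply, Circle.norm_coe,
    Finset.prod_const_one]

lemma norm_mul_sum_mFourier_le (n : Fin 2 → ℤ) (w : ℂ) {b : ℤ × ℤ} (hb : ‖latPt b‖ = 1) (ρ : ℝ) :
    ‖mFourier n (toTorus (w * latPt b)) - 1‖ *
        ‖∑ q ∈ latticeDisk ρ, mFourier n (toTorus (w * latPt q))‖ ≤
      2 * (latticeDisk (ρ + 1) \ latticeDisk (ρ + -1)).card := by
  set χ : ℤ × ℤ → ℂ := fun q => mFourier n (toTorus (w * latPt q)) with hχ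
  have hadd : ∀ q, χ (q + b) = χ b * χ q := fun q => by
    simp only [hχ, latPt_add, mul_add, mFourier_toTorus_add, mul_comm]
  have hbd : ∀ s ⊆ latticeDisk (ρ + 1) \ latticeDisk (ρ + -1),
      ‖∑ q ∈ s, χ q‖ ≤ (latticeDisk (ρ + 1) \ latticeDisk (ρ + -1)).card := fun s hs => by
    refine (norm_sum_le _ _).trans ?_
    simp only [hχ, norm_mFourier_apply, Finset.sum_const, nsmul_eq_mul, mul_one]
    exact_mod_cast Finset.card_le_card hs
  have hmap : χ b * ∑ q ∈ latticeDisk ρ, χ q =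
      ∑ q ∈ (latticeDisk ρ).map (Equiv.addRight b).toEmbedding, χ q := by
    simp [Finset.mul_sum, hadd]
  rw [← norm_mul, sub_mul, one_mul]
  change ‖χ b * ∑ q ∈ latticeDisk ρ, χ q - ∑ q ∈ latticeDisk ρ, χ q‖ ≤ _
  rw [hmap, ← Finset.sum_sdiff_sub_sum_sdiff, two_mul]
  refine (norm_sub_le _ _).trans (add_le_add (hbd _ fun q hq => ?_) (hbd _ fun q hq => ?_))
  · simp only [Finset.mem_sdiff, Finset.mem_map_equiv, mem_latticeDisk, Equiv.addRight_symm_apply,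
      ← sub_eq_add_neg, latPt_sub, not_lt] at hq ⊢
    have := norm_le_norm_add_norm_sub' (latPt q) (latPt b)
    exact ⟨by linarith, by linarith⟩
  · simp only [Finset.mem_sdiff, Finset.mem_map_equiv, mem_latticeDisk, Equiv.addRight_symm_apply,
      ← sub_eq_add_neg, latPt_sub, not_lt] at hq ⊢
    have := norm_sub_le (latPt q) (latPt b)
    exact ⟨by linarith, by linarith⟩

lemma tendsto_sum_mFourier {w : ℂ} (hw : ‖w‖ = 1)
    (hgen : ∀ p q, latPt p = w * latPt q → p = 0) {n : Fin 2 → ℤ} (hn : n ≠ 0) :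
    Tendsto (fun ρ : ℝ => (∑ q ∈ latticeDisk ρ, mFourier n (toTorus (w * latPt q))) /
      ((π * ρ ^ 2 : ℝ) : ℂ)) atTop (𝓝 0) := by
  obtain ⟨b, hb, hb1⟩ := exists_mFourier_ne_one hw hgen hn
  have hpos : 0 < ‖mFourier n (toTorus (w * latPt b)) - 1‖ := norm_pos_iff.2 (sub_ne_zero.2 hb1)
  have h := (tendsto_card_annulus (-1) 1 (by norm_num)).const_mul
    (2 / ‖mFourier n (toTorus (w * latPt b)) - 1‖)
  rw [mul_zero] at h
  refine squeeze_zero_norm (fun ρ => ?_) h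
  rw [norm_div, Complex.norm_real, norm_of_nonneg (by positivity : 0 ≤ π * ρ ^ 2), ← mul_div_assoc]
  gcongr
  rw [div_mul_eq_mul_div, le_div_iff₀ hpos, mul_comm]
  exact norm_mul_sum_mFourier_le n w hb ρ

lemma integrableOn_comp_toTorus (F : C(UnitAddTorus (Fin 2), ℂ)) :
    IntegrableOn (fun z => F (toTorus z)) (latCell 0) :=
  IntegrableOn.of_bound (by simp [volume_latCell])
    (F.continuous.comp isQuotientMap_toTorus.continuous).aestronglyMeasurable ‖F‖
    (ae_of_all _ fun _ => F.norm_coe_le_norm _)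

lemma tendsto_card_latticeDisk_complex :
    Tendsto (fun ρ : ℝ => ((latticeDisk ρ).card : ℂ) / ((π * ρ ^ 2 : ℝ) : ℂ)) atTop (𝓝 1) := by
  have := (Complex.continuous_ofReal.tendsto 1).comp (tendsto_card_latticeDisk 0)
  simpa [Function.comp_def] using this

lemma tendsto_sum_of_mem_span {w : ℂ} (hw : ‖w‖ = 1)
    (hgen : ∀ p q, latPt p = w * latPt q → p = 0) {F : C(UnitAddTorus (Fin 2), ℂ)}
    (hF : F ∈ Submodule.span ℂ (Set.range (mFourier (d := Fin 2)))) :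
    Tendsto (fun ρ : ℝ => (∑ q ∈ latticeDisk ρ, F (toTorus (w * latPt q))) /
      ((π * ρ ^ 2 : ℝ) : ℂ)) atTop (𝓝 (∫ z in latCell 0, F (toTorus z))) := by
  induction hF using Submodule.span_induction with
  | mem F hF =>
    obtain ⟨n, rfl⟩ := hF
    by_cases hn : n = 0
    · subst hn
      simpa [mFourier_zero, Measure.real, volume_latCell] using tendsto_card_latticeDisk_complex
    · rw [setIntegral_mFourier hn]
      exact tendsto_sum_mFourier hw hgen hn
  | zero => simp
  | add F G _ _ hF hG =>
    simp only [ContinuousMap.add_apply, Finset.sum_add_distrib, add_div]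
    rw [integral_add (integrableOn_comp_toTorus F) (integrableOn_comp_toTorus G)]
    exact hF.add hG
  | smul c F _ hF =>
    simp only [ContinuousMap.smul_apply, smul_eq_mul, ← Finset.mul_sum, mul_div_assoc]
    rw [integral_const_mul]
    exact hF.const_mul c

/-- Weyl equidistribution of `w ℤ²` in the torus `ℂ / ℤ²`. -/
lemma tendsto_sum_toTorus {w : ℂ} (hw : ‖w‖ = 1)
    (hgen : ∀ p q, latPt p = w * latPt q → p = 0) (F : C(UnitAddTorus (Fin 2), ℂ)) :
    Tendsto (fun ρ : ℝ => (∑ q ∈ latticeDisk ρ, F (toTorus (w * latPt q))) /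
      ((π * ρ ^ 2 : ℝ) : ℂ)) atTop (𝓝 (∫ z in latCell 0, F (toTorus z))) := by
  rw [Metric.tendsto_nhds]
  intro ε hε
  have hF : F ∈ (Submodule.span ℂ (Set.range (mFourier (d := Fin 2)))).topologicalClosure := by
    rw [span_mFourier_closure_eq_top]; trivial
  obtain ⟨G, hG, hFG⟩ := Metric.mem_closure_iff.1 hF (ε / 4) (by positivity)
  rw [dist_eq_norm] at hFG
  have hFG' : ∀ x, ‖F x - G x‖ ≤ ε / 4 := fun x => ((F - G).norm_coe_le_norm x).trans hFG.le
  have hcard := (tendsto_card_latticeDisk 0).eventually (gt_mem_nhds one_lt_two)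
  filter_upwards [Metric.tendsto_nhds.1 (tendsto_sum_of_mem_span hw hgen hG) (ε / 4)
    (by positivity), hcard] with ρ h1 h2
  rw [add_zero] at h2
  have h3 : dist ((∑ q ∈ latticeDisk ρ, F (toTorus (w * latPt q))) / ((π * ρ ^ 2 : ℝ) : ℂ))
      ((∑ q ∈ latticeDisk ρ, G (toTorus (w * latPt q))) / ((π * ρ ^ 2 : ℝ) : ℂ)) ≤ ε / 2 := by
    rw [dist_eq_norm, ← sub_div, ← Finset.sum_sub_distrib, norm_div, Complex.norm_real,
      norm_of_nonneg (by positivity : 0 ≤ π * ρ ^ 2)]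
    calc _ ≤ (latticeDisk ρ).card * (ε / 4) / (π * ρ ^ 2) := by
          gcongr
          refine (norm_sum_le_of_le _ fun q _ => hFG' _).trans_eq ?_
          simp
      _ = (latticeDisk ρ).card / (π * ρ ^ 2) * (ε / 4) := by ring
      _ ≤ 2 * (ε / 4) := by gcongr
      _ = ε / 2 := by ring
  have h4 : dist (∫ z in latCell 0, G (toTorus z)) (∫ z in latCell 0, F (toTorus z)) ≤ ε / 4 := by
    rw [dist_comm, dist_eq_norm,
      ← integral_sub (integrableOn_comp_toTorus F) (integrableOn_comp_toTorus G)]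
    refine (norm_setIntegral_le_of_norm_le_const (by simp [volume_latCell])
      fun z _ => hFG' _).trans_eq ?_
    simp [Measure.real, volume_latCell]
  exact (dist_triangle4 _ _ _ _).trans_lt
    ((add_lt_add_of_lt_of_le (add_lt_add_of_le_of_lt h3 h1) h4).trans_eq (by ring))

end Equidistribution

section PairSums

lemma exists_bound_sum_norm {g : ℂ → ℂ} (hc : Continuous g) {r : ℝ}
    (hg : ∀ z, r ≤ ‖z‖ → g z = 0) :
    ∃ C, ∀ R z, ‖z‖ ≤ R → ∑ p ∈ latticeDisk (R + r), ‖g (latPt p + z)‖ ≤ C := by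
  have hg' : ∀ z, r ≤ ‖z‖ → (‖g z‖ : ℂ) = 0 := fun z hz => by simp [hg z hz]
  have hc' : Continuous fun z => (‖g z‖ : ℂ) := by fun_prop
  obtain ⟨F, hF⟩ := exists_comp_toTorus_eq (continuous_latPer hc' hg') (latPer_latPt_add _)
  refine ⟨‖F‖, fun R z hz => ?_⟩
  have h := F.norm_coe_le_norm (toTorus z)
  rw [hF, latPer_eq_sum hg' hz, ← Complex.ofReal_sum, Complex.norm_real] at h
  exact (le_abs_self _).trans h

lemma norm_sum_sum_sub_le {g : ℂ → ℂ} {r : ℝ} (hr : 0 ≤ r) (hg : ∀ z, r ≤ ‖z‖ → g z = 0)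
    {C : ℝ}
    (hC : ∀ R z, ‖z‖ ≤ R → ∑ p ∈ latticeDisk (R + r), ‖g (latPt p + z)‖ ≤ C)
    {w : ℂ} (hw : ‖w‖ = 1) (ρ : ℝ) :
    ‖∑ q ∈ latticeDisk ρ, ∑ p ∈ latticeDisk ρ, g (latPt p - w * latPt q) -
        ∑ q ∈ latticeDisk ρ, latPer g (-w * latPt q)‖ ≤
      C * (latticeDisk (ρ + 0) \ latticeDisk (ρ + -r)).card := by
  rw [add_zero, ← Finset.sum_sub_distrib]
  have hsub : latticeDisk (ρ + -r) ⊆ latticeDisk ρ := latticeDisk_mono (by linarith)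
  have hnorm : ∀ q, ‖-w * latPt q‖ = ‖latPt q‖ := fun q => by rw [norm_mul, norm_neg, hw, one_mul]
  have hz : ∀ q ∈ latticeDisk (ρ + -r), ∑ p ∈ latticeDisk ρ, g (latPt p - w * latPt q) -
      latPer g (-w * latPt q) = 0 := fun q hq => by
    rw [mem_latticeDisk] at hq
    rw [latPer_eq_sum hg ((hnorm q).trans_le hq.le), neg_add_cancel_right, sub_eq_zero]
    simp only [sub_eq_add_neg, neg_mul]
  rw [← Finset.sum_sdiff hsub, Finset.sum_eq_zero hz, add_zero]
  refine (norm_sum_le_of_le (n := fun _ => C) _ fun q hq => ?_).trans_eq (by simp [mul_comm])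
  have hq : ‖-w * latPt q‖ ≤ ρ :=
    (hnorm q).trans_le (mem_latticeDisk.1 (Finset.mem_sdiff.1 hq).1).le
  rw [latPer_eq_sum hg hq, norm_sub_rev]
  simp only [sub_eq_add_neg, neg_mul] at hq ⊢
  rw [← sub_eq_add_neg, ← Finset.sum_sdiff (latticeDisk_mono (show ρ ≤ ρ + r by linarith)),
    add_sub_cancel_right]
  refine (norm_sum_le _ _).trans (le_trans ?_ (hC ρ _ hq))
  exact Finset.sum_le_sum_of_subset_of_nonneg Finset.sdiff_subset fun _ _ _ => norm_nonneg _

lemma tendsto_pairs_of_tendsto_latPer {g : ℂ → ℂ} (hc : Continuous g) {r : ℝ} (hr : 0 ≤ r)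
    (hg : ∀ z, r ≤ ‖z‖ → g z = 0) {w : ℂ} (hw : ‖w‖ = 1) {l : ℂ}
    (h : Tendsto (fun ρ : ℝ => (∑ q ∈ latticeDisk ρ, latPer g (-w * latPt q)) /
      ((π * ρ ^ 2 : ℝ) : ℂ)) atTop (𝓝 l)) :
    Tendsto (fun ρ : ℝ => (∑ q ∈ latticeDisk ρ, ∑ p ∈ latticeDisk ρ,
      g (latPt p - w * latPt q)) / ((π * ρ ^ 2 : ℝ) : ℂ)) atTop (𝓝 l) := by
  obtain ⟨C, hC⟩ := exists_bound_sum_norm hc hg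
  have hann := (tendsto_card_annulus (-r) 0 (by linarith)).const_mul C
  rw [mul_zero] at hann
  have hdiff := squeeze_zero_norm (fun ρ : ℝ => ?_) hann (f := fun ρ : ℝ =>
    (∑ q ∈ latticeDisk ρ, ∑ p ∈ latticeDisk ρ, g (latPt p - w * latPt q) -
        ∑ q ∈ latticeDisk ρ, latPer g (-w * latPt q)) / ((π * ρ ^ 2 : ℝ) : ℂ))
  · have := hdiff.add h
    rw [zero_add] at this
    refine this.congr fun ρ => ?_
    rw [sub_div, sub_add_cancel]
  · rw [norm_div, Complex.norm_real, norm_of_nonneg (by positivity : 0 ≤ π * ρ ^ 2),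
      ← mul_div_assoc]
    gcongr
    exact norm_sum_sum_sub_le hr hg hC hw ρ

lemma tendsto_pairs_of_inter_trivial {g : ℂ → ℂ} (hc : Continuous g) {r : ℝ} (hr : 0 ≤ r)
    (hg : ∀ z, r ≤ ‖z‖ → g z = 0) {w : ℂ} (hw : ‖w‖ = 1)
    (hgen : ∀ p q, latPt p = w * latPt q → p = 0) :
    Tendsto (fun ρ : ℝ => (∑ q ∈ latticeDisk ρ, ∑ p ∈ latticeDisk ρ,
      g (latPt p - w * latPt q)) / ((π * ρ ^ 2 : ℝ) : ℂ)) atTop (𝓝 (∫ z, g z)) := by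
  refine tendsto_pairs_of_tendsto_latPer hc hr hg hw ?_
  obtain ⟨F, hF⟩ := exists_comp_toTorus_eq (continuous_latPer hc hg) (latPer_latPt_add g)
  have h := tendsto_sum_toTorus (w := -w) (by rwa [norm_neg]) (fun p q hpq => ?_) F
  · simpa only [hF, setIntegral_latPer hc hg] using h
  · have := hgen (-p) q (by rw [← zero_sub, latPt_sub, latPt_zero, hpq]; ring)
    simpa using this

lemma tendsto_pairs_self {g : ℂ → ℂ} (hc : Continuous g) {r : ℝ} (hr : 0 ≤ r)
    (hg : ∀ z, r ≤ ‖z‖ → g z = 0) :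
    Tendsto (fun ρ : ℝ => (∑ q ∈ latticeDisk ρ, ∑ p ∈ latticeDisk ρ,
      g (latPt p - latPt q)) / ((π * ρ ^ 2 : ℝ) : ℂ)) atTop (𝓝 (∑' p, g (latPt p))) := by
  have h0 : ∑' p, g (latPt p) = latPer g 0 := by simp [latPer]
  have h1 : ∀ q, latPer g (-1 * latPt q) = latPer g 0 := fun q => by
    rw [← latPer_latPt_add g q]; simp
  have h := tendsto_pairs_of_tendsto_latPer hc hr hg (w := 1) (l := latPer g 0) norm_one ?_
  · simpa only [one_mul, h0] using h
  · simp only [h1, Finset.sum_const, nsmul_eq_mul, mul_div_right_comm]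
    simpa using tendsto_card_latticeDisk_complex.mul_const (latPer g 0)

lemma exists_comp_mul_eq_zero {f : ℂ → ℝ} (hf : HasCompactSupport f) {u : ℂ} (hu : ‖u‖ = 1) :
    ∃ r, 0 ≤ r ∧ ∀ z, r ≤ ‖z‖ → (f (u * z) : ℂ) = 0 := by
  obtain ⟨r, hr, h⟩ := hf.isCompact.isBounded.subset_ball_lt 0 0
  refine ⟨r, hr.le, fun z hz => ?_⟩
  rw [Complex.ofReal_eq_zero]
  refine image_eq_zero_of_notMem_tsupport fun hmem => ?_
  have := h hmem
  rw [mem_ball_zero_iff, norm_mul, hu, one_mul] at this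
  linarith

lemma integral_comp_mul_of_norm_eq_one {u : ℂ} (hu : ‖u‖ = 1) (g : ℂ → ℂ) :
    ∫ z, g (u * z) = ∫ z, g z :=
  let e := rotation (⟨u, mem_sphere_zero_iff_norm.2 hu⟩ : Circle)
  e.measurePreserving.integral_comp e.toHomeomorph.measurableEmbedding g

/-- Asymptotic pair sums of two rotated square lattices meeting only in the origin. -/
lemma tendsto_rot_pairs {f : ℂ → ℝ} (hc : Continuous f) (hf : HasCompactSupport f) {u v : ℂ}
    (hu : ‖u‖ = 1) (hv : ‖v‖ = 1) (hgen : ∀ p q, u * latPt p = v * latPt q → p = 0) :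
    Tendsto (fun ρ : ℝ => (∑ p ∈ latticeDisk ρ, ∑ q ∈ latticeDisk ρ,
      f (u * latPt p - v * latPt q)) / (π * ρ ^ 2)) atTop (𝓝 (∫ z, f z)) := by
  obtain ⟨r, hr, hr'⟩ := exists_comp_mul_eq_zero hf hu
  have hu0 : u ≠ 0 := norm_ne_zero_iff.1 (by simp [hu])
  have h := tendsto_pairs_of_inter_trivial (w := v / u) (g := fun z => (f (u * z) : ℂ))
    (by fun_prop) hr hr' (by simp [hu, hv]) fun p q hpq => hgen p q (by rw [hpq]; field_simp)
  rw [integral_comp_mul_of_norm_eq_one hu (fun z => (f z : ℂ)), integral_complex_ofReal] at h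
  simp_rw [mul_sub, ← mul_assoc, mul_div_cancel₀ v hu0] at h
  refine (Complex.continuous_re.tendsto _ |>.comp h).congr fun ρ => ?_
  rw [Finset.sum_comm]
  simp only [Function.comp_apply]
  norm_cast

lemma tendsto_rot_pairs_self {f : ℂ → ℝ} (hc : Continuous f) (hf : HasCompactSupport f) {u : ℂ}
    (hu : ‖u‖ = 1) :
    Tendsto (fun ρ : ℝ => (∑ p ∈ latticeDisk ρ, ∑ q ∈ latticeDisk ρ,
      f (u * latPt p - u * latPt q)) / (π * ρ ^ 2)) atTop (𝓝 (∑' p, f (u * latPt p))) := by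
  obtain ⟨r, hr, hr'⟩ := exists_comp_mul_eq_zero hf hu
  have h := tendsto_pairs_self (g := fun z => (f (u * z) : ℂ)) (by fun_prop) hr hr'
  simp_rw [mul_sub, ← Complex.ofReal_tsum] at h
  refine (Complex.continuous_re.tendsto _ |>.comp h).congr fun ρ => ?_
  rw [Finset.sum_comm]
  simp only [Function.comp_apply]
  norm_cast

end PairSums

section Measures

lemma norm_mul_latPt {u : ℂ} (hu : ‖u‖ = 1) (p : ℤ × ℤ) : ‖u * latPt p‖ = ‖latPt p‖ := by
  rw [norm_mul, hu, one_mul]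

lemma restrict_rotLatticeComb {u : ℂ} (hu : ‖u‖ = 1) (ρ : ℝ) :
    (rotLatticeComb u).restrict (Metric.ball 0 ρ) =
      ∑ p ∈ latticeDisk ρ, Measure.dirac (u * latPt p) := by
  classical
  rw [rotLatticeComb, Measure.restrict_sum _ Metric.isOpen_ball.measurableSet]
  ext s hs
  rw [Measure.sum_apply _ hs, Measure.finsetSum_apply, tsum_eq_sum (s := latticeDisk ρ)]
  · refine Finset.sum_congr rfl fun p hp => ?_
    rw [mem_latticeDisk] at hp
    rw [restrict_dirac, if_pos (by simpa [hu] using hp)]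
  · intro p hp
    rw [mem_latticeDisk] at hp
    rw [restrict_dirac, if_neg (by simpa [hu] using hp)]
    rfl

lemma summable_one_add_norm_latPt : Summable fun p => (1 + ‖latPt p‖) ^ (-((3 : ℕ) : ℝ)) := by
  have h := (finTwoArrowEquiv ℤ).symm.summable_iff.2
    (EisensteinSeries.summable_one_div_norm_rpow (k := 3) (by norm_num))
  refine Summable.of_norm_bounded_eventually h ?_
  have h0 : ∀ᶠ p : ℤ × ℤ in cofinite, p ≠ 0 := by simp [eventually_cofinite]
  filter_upwards [h0] with p hp
  have hp' : ((finTwoArrowEquiv ℤ).symm p) ≠ 0 := fun h => hp (by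
    have h0 := congrFun h 0
    have h1 := congrFun h 1
    exact Prod.ext h0 h1)
  have hle : ‖(finTwoArrowEquiv ℤ).symm p‖ ≤ 1 + ‖latPt p‖ := by
    rw [pi_norm_le_iff_of_nonneg (by positivity)]
    have h1 := Complex.abs_re_le_norm (latPt p)
    have h2 := Complex.abs_im_le_norm (latPt p)
    rw [latPt_re] at h1
    rw [latPt_im] at h2
    intro i
    fin_cases i <;> simp [Int.norm_eq_abs] <;> linarith
  rw [norm_of_nonneg (by positivity)]
  exact Real.rpow_le_rpow_of_nonpos (norm_pos_iff.2 hp') hle (by norm_num)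

lemma integrable_rotLatticeComb {E : Type*} [NormedAddCommGroup E] [NormedSpace ℝ E]
    {u : ℂ} {f : ℂ → E} (hs : Summable fun p => ‖f (u * latPt p)‖) :
    Integrable f (rotLatticeComb u) :=
  integrable_sum_measure (fun _ => integrable_dirac (by simp)) (by simpa using hs)

lemma hasTemperateGrowth_rotLatticeComb {u : ℂ} (hu : ‖u‖ = 1) :
    (rotLatticeComb u).HasTemperateGrowth := by
  refine ⟨3, integrable_rotLatticeComb ?_⟩
  simpa only [norm_mul_latPt hu] using summable_one_add_norm_latPt.norm

lemma integrable_schwartz_rotLatticeComb {u : ℂ} (hu : ‖u‖ = 1) (f : SchwartzMap ℂ ℂ) :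
    Integrable f (rotLatticeComb u) :=
  have := hasTemperateGrowth_rotLatticeComb hu
  f.integrable

lemma integrable_rotLatticeComb_of_hasCompactSupport {u : ℂ} (hu : ‖u‖ = 1) {f : ℂ → ℝ}
    (hfc : HasCompactSupport f) :
    Integrable f (rotLatticeComb u) := by
  obtain ⟨r, -, hr⟩ := exists_comp_mul_eq_zero hfc hu
  refine integrable_rotLatticeComb (summable_of_ne_finset_zero (s := latticeDisk r) fun p hp => ?_)
  rw [mem_latticeDisk, not_lt] at hp
  simpa using hr _ hp

lemma integral_rotLatticeComb {u : ℂ} {f : ℂ → ℝ} (hf : Integrable f (rotLatticeComb u)) :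
    ∫ z, f z ∂(rotLatticeComb u) = ∑' p, f (u * latPt p) := by
  rw [rotLatticeComb, integral_sum_measure hf]
  simp

lemma integral_smul_add_smul_sum {E : Type*} [NormedAddCommGroup E] [NormedSpace ℝ E] {ι : Type*}
    [Fintype ι] {a b : ℝ≥0∞} (ha : a ≠ ∞) (hb : b ≠ ∞) {f : ℂ → E} {μ : Measure ℂ}
    {ν : ι → Measure ℂ} (hμ : Integrable f μ) (hν : ∀ j, Integrable f (ν j)) :
    ∫ z, f z ∂(a • μ + b • ∑ j, ν j) =
      a.toReal • ∫ z, f z ∂μ + b.toReal • ∑ j, ∫ z, f z ∂(ν j) := by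
  rw [integral_add_measure (hμ.smul_measure ha)
    ((integrable_finsetSum_measure.2 fun j _ => hν j).smul_measure hb),
    integral_smul_measure, integral_smul_measure, integral_finsetSum_measure fun j _ => hν j]

lemma integral_smul_sum_sum_dirac {N : ℕ} (c : ℝ≥0∞) (u : Fin N → ℂ) (s : Finset (ℤ × ℤ))
    (h : ℂ → ℝ) :
    ∫ z, h z ∂(c • ∑ j, ∑ p ∈ s, Measure.dirac (u j * latPt p)) =
      c.toReal * ∑ j, ∑ p ∈ s, h (u j * latPt p) := by
  have hint : ∀ z : ℂ, Integrable h (Measure.dirac z) := fun z => integrable_dirac (by simp)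
  rw [integral_smul_measure, integral_finsetSum_measure fun j _ =>
    integrable_finsetSum_measure.2 fun p _ => hint _, smul_eq_mul]
  congr 1
  refine Finset.sum_congr rfl fun j _ => ?_
  rw [integral_finsetSum_measure fun p _ => hint _]
  simp

lemma integral_autocorrelation_approximant {N : ℕ} (hN : N ≠ 0) {u : Fin N → ℂ}
    (hu : ∀ j, ‖u j‖ = 1) {f : ℂ → ℝ} (hf : Continuous f) (hfc : HasCompactSupport f) (ρ : ℝ) :
    ∫ z, f z ∂((ENNReal.ofReal (π * ρ ^ 2))⁻¹ •
      Measure.map (fun q : ℂ × ℂ => q.1 - q.2)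
        ((((N : ℝ≥0∞)⁻¹ • ∑ j, rotLatticeComb (u j)).restrict (Metric.ball (0 : ℂ) ρ)).prod
          (((N : ℝ≥0∞)⁻¹ • ∑ j, rotLatticeComb (u j)).restrict (Metric.ball (0 : ℂ) ρ)))) =
      ((N : ℝ) ^ 2)⁻¹ * ∑ j, ∑ k, (∑ p ∈ latticeDisk ρ, ∑ q ∈ latticeDisk ρ,
        f (u j * latPt p - u k * latPt q)) / (π * ρ ^ 2) := by
  have hres : ((N : ℝ≥0∞)⁻¹ • ∑ j, rotLatticeComb (u j)).restrict (Metric.ball (0 : ℂ) ρ) =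
      (N : ℝ≥0∞)⁻¹ • ∑ j, ∑ p ∈ latticeDisk ρ, Measure.dirac (u j * latPt p) := by
    rw [Measure.restrict_smul, ← Measure.sum_fintype, Measure.restrict_sum _ measurableSet_ball,
      Measure.sum_fintype]
    simp_rw [restrict_rotLatticeComb (hu _)]
  rw [hres]
  set μ := (N : ℝ≥0∞)⁻¹ • ∑ j, ∑ p ∈ latticeDisk ρ, Measure.dirac (u j * latPt p) with hμ
  have hfin : IsFiniteMeasure μ := Measure.smul_finite _ (by simp [hN])
  obtain ⟨C, hC⟩ := hfc.exists_bound_of_continuous hf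
  have hcont : Continuous fun q : ℂ × ℂ => f (q.1 - q.2) := by fun_prop
  have hint : Integrable (fun q : ℂ × ℂ => f (q.1 - q.2)) (μ.prod μ) :=
    Integrable.of_bound hcont.aestronglyMeasurable C (ae_of_all _ fun _ => hC _)
  rw [integral_smul_measure, integral_map (by fun_prop) hf.aestronglyMeasurable,
    integral_prod _ hint]
  simp_rw [hμ, integral_smul_sum_sum_dirac]
  simp only [ENNReal.toReal_inv, ENNReal.toReal_natCast, smul_eq_mul,
    ENNReal.toReal_ofReal (by positivity : 0 ≤ π * ρ ^ 2)]
  simp only [← Finset.sum_div, ← Finset.mul_sum]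
  simp_rw [Finset.sum_comm (s := latticeDisk ρ) (t := Finset.univ)]
  ring

end Measures

/-- Let `Γ_j = R_j ℤ²`, `j = 1, …, N`, be rotated copies of the square lattice
with `Γ_j ∩ Γ_k = {0}` for `j ≠ k`, and `ω = (1/N) ∑_j δ_{Γ_j}`. Then the
autocorrelation of `ω` is `γ_ω = ((N−1)/N)·λ + (1/N²) ∑_j δ_{Γ_j}`, and the
diffraction is `γ̂_ω = ((N−1)/N)·δ_0 + (1/N)·((1/N) ∑_j δ̂_{Γ_j})`, as tempered
distributions. -/
theorem multiple_rotated_lattices_autocorrelation_and_diffraction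
    (N : ℕ) (hN : 1 ≤ N) (u : Fin N → ℂ) (hu : ∀ j, ‖u j‖ = 1)
    (hgen : ∀ j k, j ≠ k →
      {z : ℂ | ∃ p : ℤ × ℤ, z = u j * latPt p} ∩
      {z : ℂ | ∃ p : ℤ × ℤ, z = u k * latPt p} = {0}) :
    (∀ f : ℂ → ℝ, Continuous f → HasCompactSupport f →
      Tendsto (fun ρ : ℝ =>
          ∫ z, f z ∂((ENNReal.ofReal (π * ρ ^ 2))⁻¹ •
            Measure.map (fun q : ℂ × ℂ => q.1 - q.2)
              ((((N : ℝ≥0∞)⁻¹ • ∑ j, rotLatticeComb (u j)).restrict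
                  (Metric.ball (0 : ℂ) ρ)).prod
                (((N : ℝ≥0∞)⁻¹ • ∑ j, rotLatticeComb (u j)).restrict
                  (Metric.ball (0 : ℂ) ρ)))))
        atTop
        (nhds (∫ z, f z ∂((((N : ℝ≥0∞) - 1) / (N : ℝ≥0∞)) • volume +
          ((N : ℝ≥0∞) ^ 2)⁻¹ • ∑ j, rotLatticeComb (u j))))) ∧
    (∀ f : SchwartzMap ℂ ℂ,
      ∫ z, 𝓕 (⇑f) z ∂((((N : ℝ≥0∞) - 1) / (N : ℝ≥0∞)) • volume +
          ((N : ℝ≥0∞) ^ 2)⁻¹ • ∑ j, rotLatticeComb (u j)) =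
      ((((N : ℝ) - 1) / (N : ℝ)) : ℝ) * f 0 +
        (((N : ℝ) ^ 2)⁻¹ : ℝ) * ∑ j, ∫ z, 𝓕 (⇑f) z ∂(rotLatticeComb (u j))) := by
  have hN0 : (N : ℝ) ≠ 0 := by positivity
  have hNe : (N : ℝ≥0∞) ≠ 0 := by exact_mod_cast (by lia : N ≠ 0)
  have hc1 : ((N : ℝ≥0∞) - 1) / N ≠ ∞ := ENNReal.div_ne_top (by simp) hNe
  have hc2 : ((N : ℝ≥0∞) ^ 2)⁻¹ ≠ ∞ := by simp [hNe]
  have hr1 : (((N : ℝ≥0∞) - 1) / N).toReal = ((N : ℝ) - 1) / N := by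
    rw [ENNReal.toReal_div, ENNReal.toReal_sub_of_le (by exact_mod_cast hN) (by simp)]
    simp
  have hr2 : (((N : ℝ≥0∞) ^ 2)⁻¹).toReal = ((N : ℝ) ^ 2)⁻¹ := by simp
  constructor
  · intro f hf hfc
    simp_rw [integral_autocorrelation_approximant (by lia : N ≠ 0) hu hf hfc]
    rw [integral_smul_add_smul_sum hc1 hc2 (hf.integrable_of_hasCompactSupport hfc)
      fun j => integrable_rotLatticeComb_of_hasCompactSupport (hu j) hfc, hr1, hr2]
    have hlim : ∀ j k, Tendsto (fun ρ : ℝ => (∑ p ∈ latticeDisk ρ, ∑ q ∈ latticeDisk ρ,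
        f (u j * latPt p - u k * latPt q)) / (π * ρ ^ 2)) atTop
        (𝓝 ((∫ z, f z) +
          if j = k then ∫ z, f z ∂(rotLatticeComb (u j)) - ∫ z, f z else 0)) := by
      intro j k
      split_ifs with hjk
      · subst hjk
        rw [add_sub_cancel, integral_rotLatticeComb
          (integrable_rotLatticeComb_of_hasCompactSupport (hu j) hfc)]
        exact tendsto_rot_pairs_self hf hfc (hu j)
      · rw [add_zero]
        refine tendsto_rot_pairs hf hfc (hu j) (hu k) fun p q hpq => ?_
        have hmem : u j * latPt p ∈ ({0} : Set ℂ) := hgen j k hjk ▸ ⟨⟨p, rfl⟩, ⟨q, hpq⟩⟩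
        have huj : u j ≠ 0 := norm_ne_zero_iff.1 (by simp [hu])
        exact latPt_injective (by simpa [huj, latPt_zero] using hmem)
    have hsum := (tendsto_finsetSum Finset.univ fun j _ =>
      tendsto_finsetSum Finset.univ fun k _ => hlim j k).const_mul ((N : ℝ) ^ 2)⁻¹
    convert hsum using 2
    simp only [smul_eq_mul, Finset.sum_add_distrib, Finset.sum_sub_distrib, Finset.sum_ite_eq,
      Finset.mem_univ, if_true, Finset.sum_const, Finset.card_univ, Fintype.card_fin, nsmul_eq_mul]
    field_simp
    ring
  · intro f
    have hint : Integrable (𝓕 (f : ℂ → ℂ)) := (𝓕 f : SchwartzMap ℂ ℂ).integrable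
    have hint' : ∀ j, Integrable (𝓕 (f : ℂ → ℂ)) (rotLatticeComb (u j)) :=
      fun j => integrable_schwartz_rotLatticeComb (hu j) (𝓕 f)
    have hinv : ∫ z, 𝓕 (f : ℂ → ℂ) z = f 0 := by
      have h := congrFun (f.continuous.fourierInv_fourier_eq f.integrable hint) 0
      rw [Real.fourierInv_eq] at h
      simpa using h
    rw [integral_smul_add_smul_sum hc1 hc2 hint hint', hr1, hr2, hinv]
    simp only [Complex.real_smul]
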